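/- arXiv:1101.1112 — 10 statements merged into one kernel-verified Lean document; each statement's English description precedes it below -/
import Mathlib

section
/- Let R be a commutative ring, let A and B be associative unital R-algebras, and let φ : A → B be a surjective R-algebra homomorphism. Then an R-submodule V of B is a two-sided Mathieu subspace of B if and only if the preimage φ⁻¹(V) is a two-sided Mathieu subspace of A. -/
/-- `M` is a two-sided Mathieu subspace of the `R`-algebra `A`. -/
def IsMathieuTS {R A : Type*} [CommRing R] [Ring A] [Algebra R A] (M : Submodule R A) : Prop :=
  ∀ a b c : A, (∀ m : ℕ, 1 ≤ m → a ^ m ∈ M) →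
    ∃ N : ℕ, ∀ m : ℕ, N ≤ m → b * a ^ m * c ∈ M

theorem mathieu_comap_iff {R A B : Type*} [CommRing R] [Ring A] [Ring B]
    [Algebra R A] [Algebra R B] (φ : A →ₐ[R] B) (hφ : Function.Surjective φ)
    (V : Submodule R B) :
    IsMathieuTS V ↔ IsMathieuTS (V.comap φ.toLinearMap) := by
  simp only [IsMathieuTS, Submodule.mem_comap, AlgHom.toLinearMap_apply, map_mul, map_pow,
    hφ.forall]
end

section
/- Let R be a commutative ring, A an associative unital R-algebra, and M a two-sided Mathieu subspace of A. Let a ∈ A be such that a lies in the radical r(M) and a^N = a^(N+1) * p(a) for some N ∈ ℕ and some polynomial p ∈ R[t]. Then the two-sided ideal of A generated by a^N is contained in M; in particular every finite sum Σᵢ bᵢ * a^N * cᵢ with bᵢ, cᵢ ∈ A lies in M. -/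
/-- The radical of a set: elements all of whose sufficiently large powers lie in the set. -/
def radSet {A : Type*} [Monoid A] (S : Set A) : Set A :=
  {a | ∃ N : ℕ, ∀ m : ℕ, N ≤ m → a ^ m ∈ S}

/-- If `a ^ N = a ^ (N + 1) * q` then powers of `a` from `a ^ N` on absorb the elements
`a ^ j * q ^ j`. -/
theorem pow_eq_pow_add_mul_pow_of_le {A : Type*} [Monoid A] {a q : A} {N : ℕ}
    (hq : a ^ N = a ^ (N + 1) * q) {K : ℕ} (hK : N ≤ K) (j : ℕ) :
    a ^ K = a ^ (K + j) * q ^ j := by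
  have step (m : ℕ) (hm : N ≤ m) : a ^ m = a ^ (m + 1) * q := by
    obtain ⟨d, rfl⟩ := Nat.exists_eq_add_of_le' hm
    rw [pow_add, hq, ← mul_assoc, ← pow_add, add_assoc]
  induction j with
  | zero => simp
  | succ j ih => rw [ih, step (K + j) (by lia), mul_assoc, ← pow_succ', add_assoc]

/-- A submodule containing all powers of `a` from `a ^ K` on contains all multiples of `a ^ K` by
polynomials in `a`. -/
theorem Submodule.pow_mul_aeval_mem {R A : Type*} [CommRing R] [Ring A] [Algebra R A]
    (M : Submodule R A) {a : A} {K : ℕ} (h : ∀ m, K ≤ m → a ^ m ∈ M) (f : Polynomial R) :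
    a ^ K * Polynomial.aeval a f ∈ M := by
  rw [Polynomial.aeval_eq_sum_range, Finset.mul_sum]
  refine M.sum_mem fun i _ => ?_
  rw [mul_smul_comm, ← pow_add]
  exact M.smul_mem _ (h _ (Nat.le_add_right K i))

/-- A two-sided Mathieu subspace contains the two-sided ideal generated by each of its
idempotents. -/
theorem IsMathieuTS.mul_mul_mem_of_isIdempotentElem {R A : Type*} [CommRing R] [Ring A]
    [Algebra R A] {M : Submodule R A} (hM : IsMathieuTS M) {e : A} (he : IsIdempotentElem e)
    (heM : e ∈ M) (b c : A) : b * e * c ∈ M := by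
  have hpow (m : ℕ) (hm : 1 ≤ m) : e ^ m = e := he.pow_eq (by lia)
  obtain ⟨N, hN⟩ := hM e b c fun m hm => by rwa [hpow m hm]
  simpa [hpow (N + 1) (by lia)] using hN (N + 1) (by lia)

/-- A submodule containing all products `b * x * c` contains the two-sided ideal generated by
`x`. -/
theorem Submodule.twoSidedIdealSpan_singleton_subset {R A : Type*} [CommRing R] [Ring A]
    [Algebra R A] (M : Submodule R A) {x : A} (h : ∀ b c : A, b * x * c ∈ M) :
    ((TwoSidedIdeal.span {x} : TwoSidedIdeal A) : Set A) ⊆ (M : Set A) := by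
  let I : TwoSidedIdeal A := .mk' {y | ∀ b c : A, b * y * c ∈ M}
    (by simp)
    (fun {y z} hy hz b c => by simpa [mul_add, add_mul] using M.add_mem (hy b c) (hz b c))
    (fun {y} hy b c => by simpa using hy b c)
    (fun {y z} hz b c => by simpa [mul_assoc] using hz (b * y) c)
    (fun {y z} hy b c => by simpa [mul_assoc] using hy b (z * c))
  intro y hy
  have hyI : y ∈ I := by
    refine TwoSidedIdeal.span_le.mpr ?_ hy
    rintro _ rfl
    simpa [I, TwoSidedIdeal.mem_mk'] using h
  simp only [I, TwoSidedIdeal.mem_mk', Set.mem_ofPred_eq] at hyI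
  simpa using hyI 1 1

theorem ideal_pow_subset_of_mem_radical {R A : Type*} [CommRing R] [Ring A] [Algebra R A]
    (M : Submodule R A) (hM : IsMathieuTS M) (a : A) (ha : a ∈ radSet (M : Set A))
    (N : ℕ) (p : Polynomial R) (hco : a ^ N = a ^ (N + 1) * Polynomial.aeval a p) :
    ((TwoSidedIdeal.span {a ^ N} : TwoSidedIdeal A) : Set A) ⊆ (M : Set A) ∧
      ∀ (k : ℕ) (b c : Fin k → A), (∑ i, b i * a ^ N * c i) ∈ M := by
  obtain ⟨n, hn⟩ := ha
  set q := Polynomial.aeval a p with hq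
  have hcomm : Commute a q := by
    simpa using (Commute.all Polynomial.X p).map (Polynomial.aeval a)
  set K := max N n
  have hidem : IsIdempotentElem (a ^ K * q ^ K) := by
    have hK := pow_eq_pow_add_mul_pow_of_le hco (le_max_left N n) K
    calc a ^ K * q ^ K * (a ^ K * q ^ K) = a ^ (K + K) * q ^ K * q ^ K := by
          rw [pow_add, mul_assoc, ← mul_assoc (q ^ K), ← (hcomm.pow_pow K K).eq]
          simp only [mul_assoc]
      _ = a ^ K * q ^ K := by rw [← hK]
  have hmem : a ^ K * q ^ K ∈ M := by
    rw [hq, ← map_pow]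
    exact M.pow_mul_aeval_mem (fun m hm => hn m ((le_max_right N n).trans hm)) _
  have habs : a ^ N = a ^ K * q ^ K * a ^ N := by
    rw [mul_assoc, ← (hcomm.pow_pow N K).eq, ← mul_assoc, ← pow_add, add_comm]
    exact pow_eq_pow_add_mul_pow_of_le hco le_rfl K
  have key (b c : A) : b * a ^ N * c ∈ M := by
    rw [habs, ← mul_assoc b, mul_assoc]
    exact hM.mul_mul_mem_of_isIdempotentElem hidem hmem b _
  exact ⟨M.twoSidedIdealSpan_singleton_subset key, fun k b c => M.sum_mem fun i _ => key _ _⟩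
end

section
/- Let R be a commutative ring, A an associative unital R-algebra, and M a two-sided Mathieu subspace of A. Let a ∈ A be a semi-idempotent (i.e. a = r * a² for some r ∈ R) lying in the radical r(M). Then the two-sided ideal of A generated by a is contained in M. -/
theorem eq_smul_pow_succ_of_eq_smul_sq {R A : Type*} [CommRing R] [Ring A] [Algebra R A]
    {a : A} {r : R} (h : a = r • a ^ 2) (k : ℕ) : a = r ^ k • a ^ (k + 1) := by
  induction k with
  | zero => simp
  | succ k ih =>
    calc a = r ^ k • (a ^ k * a) := by rw [← pow_succ]; exact ih
      _ = r ^ k • (a ^ k * (r • a ^ 2)) := by rw [← h]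
      _ = r ^ (k + 1) • a ^ (k + 1 + 1) := by
        rw [mul_smul_comm, smul_smul, ← pow_succ, ← pow_add]

theorem ideal_subset_of_semiIdempotent_mem_radical {R A : Type*} [CommRing R] [Ring A]
    [Algebra R A] (M : Submodule R A) (hM : IsMathieuTS M) (a : A)
    (hsemi : ∃ r : R, a = r • a ^ 2) (ha : a ∈ radSet (M : Set A)) :
    ((TwoSidedIdeal.span {a} : TwoSidedIdeal A) : Set A) ⊆ (M : Set A) := by
  obtain ⟨r, hr⟩ := hsemi
  obtain ⟨N, hN⟩ := ha
  have pow_mem : ∀ m : ℕ, 1 ≤ m → a ^ m ∈ M := by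
    intro m hm
    obtain ⟨n, rfl⟩ := Nat.exists_eq_add_of_le' hm
    have key : a ^ (n + 1) = r ^ N • a ^ (n + (N + 1)) := by
      rw [pow_add a n (N + 1), ← mul_smul_comm, ← eq_smul_pow_succ_of_eq_smul_sq hr N, pow_succ]
    rw [key]
    exact M.smul_mem _ (hN _ (by omega))
  have mul_mul_mem (b c : A) : b * a * c ∈ M := by
    obtain ⟨K, hK⟩ := hM a b c pow_mem
    rw [eq_smul_pow_succ_of_eq_smul_sq hr K, mul_smul_comm, smul_mul_assoc]
    exact M.smul_mem _ (hK _ (by omega))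
  intro x hx
  rw [SetLike.mem_coe, TwoSidedIdeal.mem_span_iff_mem_addSubgroup_closure] at hx
  refine (AddSubgroup.closure_le M.toAddSubgroup).2 ?_ hx
  rintro _ ⟨_, ⟨b, -, _, rfl, rfl⟩, c, -, rfl⟩
  exact mul_mul_mem b c
end

section
/- Let R be a commutative ring, A an associative unital R-algebra, and V an R-submodule of A. Let a ∈ A and N ∈ ℕ be such that a^m ∈ V for all sufficiently large m and a^N = a^(N+1) * q(a) for some polynomial q ∈ R[t]. Then there exists a polynomial p ∈ R[t] divisible by t^N such that, writing e = p(a): (i) e ∈ V; (ii) e² = e; (iii) a^N = a^N * e = e * a^N. Moreover: (iv) a is nilpotent if and only if a^N = 0, if and only if e = 0; and (v) a is a unit of A if and only if a is not a zero divisor in the subalgebra R[a] generated by a (i.e. a * x = 0 with x ∈ R[a] implies x = 0), if and only if e = 1. -/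
open Polynomial

/-- If all powers `a ^ m` with `m ≥ M` lie in `V`, so does the value at `a` of every polynomial
divisible by `X ^ M`. -/
theorem aeval_X_pow_mul_mem {R A : Type*} [CommRing R] [Ring A] [Algebra R A]
    {V : Submodule R A} {a : A} {M : ℕ} (h : ∀ m : ℕ, M ≤ m → a ^ m ∈ V) (f : R[X]) :
    aeval a (X ^ M * f) ∈ V := by
  rw [map_mul, aeval_X_pow, aeval_eq_sum_range, Finset.mul_sum]
  refine V.sum_mem fun i _ ↦ ?_
  rw [mul_smul_comm, ← pow_add]
  exact V.smul_mem _ (h _ (Nat.le_add_right M i))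

/-- The co-integrality relation can be iterated. -/
theorem aeval_X_pow_mul_X_mul_pow {R A : Type*} [CommRing R] [Ring A] [Algebra R A]
    {a : A} {N : ℕ} {q : R[X]} (hco : a ^ N = a ^ (N + 1) * aeval a q) (k : ℕ) :
    aeval a (X ^ N * (X * q) ^ k) = a ^ N := by
  induction k with
  | zero => simp
  | succ k ih =>
    rw [pow_succ, ← mul_assoc, map_mul, ih]
    simpa [pow_succ, mul_assoc] using hco.symm

theorem eq_zero_of_pow_mul_eq_zero_of_mem_adjoin {R A : Type*} [CommRing R] [Ring A]
    [Algebra R A] {a : A} (h : ∀ x ∈ Algebra.adjoin R ({a} : Set A), a * x = 0 → x = 0)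
    {x : A} (hx : x ∈ Algebra.adjoin R ({a} : Set A)) {n : ℕ} (hn : a ^ n * x = 0) : x = 0 := by
  induction n with
  | zero => simpa using hn
  | succ n ih =>
    have ha : a ∈ Algebra.adjoin R ({a} : Set A) := Algebra.self_mem_adjoin_singleton R a
    refine ih (h _ (mul_mem (pow_mem ha n) hx) ?_)
    rwa [← mul_assoc, ← pow_succ']

theorem exists_idempotent_of_coIntegral_mem_radical {R A : Type*} [CommRing R] [Ring A]
    [Algebra R A] (V : Submodule R A) (a : A) (N : ℕ)
    (hrad : ∃ M₀ : ℕ, ∀ m : ℕ, M₀ ≤ m → a ^ m ∈ V)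
    (q : R[X]) (hco : a ^ N = a ^ (N + 1) * aeval a q) :
    ∃ p : R[X], (X : R[X]) ^ N ∣ p ∧
      aeval a p ∈ V ∧
      (aeval a p) ^ 2 = aeval a p ∧
      a ^ N = a ^ N * aeval a p ∧
      a ^ N = aeval a p * a ^ N ∧
      (IsNilpotent a ↔ a ^ N = 0) ∧
      (a ^ N = 0 ↔ aeval a p = 0) ∧
      (IsUnit a ↔ (∀ x ∈ Algebra.adjoin R ({a} : Set A), a * x = 0 → x = 0)) ∧
      ((∀ x ∈ Algebra.adjoin R ({a} : Set A), a * x = 0 → x = 0) ↔ aeval a p = 1) := by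
  obtain ⟨M₀, hM₀⟩ := hrad
  set M := N + M₀ + 1 with hM
  set p : R[X] := (X * q) ^ M with hp
  have iterate := aeval_X_pow_mul_X_mul_pow hco
  have fixes : a ^ N * aeval a p = a ^ N := by
    simpa only [map_mul, aeval_X_pow] using iterate M
  have fixes' : aeval a p * a ^ N = a ^ N := by
    rw [← aeval_X_pow (R := R) a, ← map_mul, mul_comm, map_mul, aeval_X_pow, fixes]
  have factor : p = X ^ N * (X ^ (M₀ + 1) * q ^ M) := by
    rw [hp, mul_pow, ← mul_assoc, ← pow_add, hM, add_assoc]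
  have e_eq : aeval a p = aeval a (X ^ (M₀ + 1) * q ^ M) * a ^ N := by
    rw [factor, mul_comm, map_mul, aeval_X_pow]
  have unit_of_eq_one : aeval a p = 1 → IsUnit a := by
    intro h
    rw [hp, hM, map_pow, map_mul, aeval_X] at h
    have comm : Commute a (aeval a q) := by
      simpa using (Commute.all X q).map (aeval (R := R) a)
    exact (comm.isUnit_mul_iff.mp (IsUnit.of_pow_eq_one h (Nat.succ_ne_zero _))).1
  have regular_of_unit (h : IsUnit a) :
      ∀ x ∈ Algebra.adjoin R ({a} : Set A), a * x = 0 → x = 0 :=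
    fun x _ hx ↦ h.mul_right_eq_zero.mp hx
  have eq_one_of_regular (h : ∀ x ∈ Algebra.adjoin R ({a} : Set A), a * x = 0 → x = 0) :
      aeval a p = 1 := by
    have mem : 1 - aeval a p ∈ Algebra.adjoin R ({a} : Set A) :=
      sub_mem (one_mem _) (aeval_mem_adjoin_singleton R a)
    refine (sub_eq_zero.mp (eq_zero_of_pow_mul_eq_zero_of_mem_adjoin h mem (n := N) ?_)).symm
    rw [mul_sub, mul_one, fixes, sub_self]
  refine ⟨p, ⟨_, factor⟩, ?_, ?_, fixes.symm, fixes'.symm, ⟨?_, fun h ↦ ⟨N, h⟩⟩,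
    ⟨fun h ↦ by rw [e_eq, h, mul_zero], fun h ↦ by rw [← fixes, h, mul_zero]⟩,
    ⟨regular_of_unit, fun h ↦ unit_of_eq_one (eq_one_of_regular h)⟩,
    ⟨eq_one_of_regular, fun h ↦ regular_of_unit (unit_of_eq_one h)⟩⟩
  · rw [hp, mul_pow]
    exact aeval_X_pow_mul_mem (fun m hm ↦ hM₀ m (by omega)) _
  · rw [sq]
    nth_rw 1 [e_eq]
    rw [mul_assoc, fixes, ← e_eq]
  · rintro ⟨k, hk⟩
    rw [← iterate k, mul_pow, map_mul, map_mul, aeval_X_pow, aeval_X_pow, hk, zero_mul, mul_zero]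
end

section
/- Let R be a commutative ring and A an associative unital R-algebra such that every element of A is co-integral over R and every non-unit of A is nilpotent. Then every R-submodule V of A with 1 ∉ V is a two-sided Mathieu subspace of A. -/
/-- `a` is co-integral over `R`. -/
def CoIntegral (R : Type*) {A : Type*} [CommRing R] [Ring A] [Algebra R A] (a : A) : Prop :=
  ∃ (N : ℕ) (p : Polynomial R), a ^ N = a ^ (N + 1) * Polynomial.aeval a p

theorem mul_aeval_mem_of_pow_mem {R A : Type*} [CommRing R] [Ring A] [Algebra R A]
    {V : Submodule R A} {a : A} (ha : ∀ m : ℕ, 1 ≤ m → a ^ m ∈ V) (p : Polynomial R) :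
    a * Polynomial.aeval a p ∈ V := by
  rw [Polynomial.aeval_eq_sum_range, Finset.mul_sum]
  refine V.sum_mem fun i _ => ?_
  rw [mul_smul_comm, ← pow_succ']
  exact V.smul_mem _ (ha _ (Nat.le_add_left 1 i))

theorem quasiStable_of_coIntegral_of_nonunits_nilpotent {R A : Type*} [CommRing R] [Ring A]
    [Algebra R A] (hco : ∀ a : A, CoIntegral R a)
    (hnil : ∀ a : A, ¬ IsUnit a → IsNilpotent a)
    (V : Submodule R A) (h1 : (1 : A) ∉ V) :
    IsMathieuTS V := by
  intro a b c ha
  by_cases hu : IsUnit a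
  · obtain ⟨N, p, hp⟩ := hco a
    refine absurd ?_ h1
    have h : (1 : A) = a * Polynomial.aeval a p :=
      (hu.pow N).mul_left_cancel (by rw [mul_one, ← mul_assoc, ← pow_succ, ← hp])
    rw [h]
    exact mul_aeval_mem_of_pow_mem ha p
  · obtain ⟨N, hN⟩ := hnil a hu
    exact ⟨N, fun m hm => by simp [pow_eq_zero_of_le hm hN]⟩
end

section
/- Let R be a commutative ring, A a commutative unital R-algebra, and V an R-submodule of A such that every element of the radical r(V) lies in the ideal of A generated by the co-integral elements of r(V). Then V is a Mathieu subspace of A if and only if for every idempotent e ∈ V the ideal A * e is contained in V. -/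
/-- `M` is a Mathieu subspace of the commutative `R`-algebra `A`. -/
def IsMathieu {R A : Type*} [CommRing R] [CommRing A] [Algebra R A] (M : Submodule R A) : Prop :=
  ∀ a b : A, (∀ m : ℕ, 1 ≤ m → a ^ m ∈ M) →
    ∃ N : ℕ, ∀ m : ℕ, N ≤ m → b * a ^ m ∈ M

/-- The polynomial expressions in `a` divisible by a large power of `a` lie in every submodule
whose radical contains `a`. -/
theorem exists_pow_mul_aeval_mem_of_mem_radSet {R A : Type*} [CommRing R] [CommRing A]
    [Algebra R A] {V : Submodule R A} {a : A} (ha : a ∈ radSet (V : Set A)) :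
    ∃ K : ℕ, ∀ M : ℕ, K ≤ M → ∀ q : Polynomial R, a ^ M * Polynomial.aeval a q ∈ V := by
  obtain ⟨K, hK⟩ := ha
  refine ⟨K, fun M hM q => ?_⟩
  rw [Polynomial.aeval_eq_sum_range, Finset.mul_sum]
  refine V.sum_mem fun i _ => ?_
  rw [mul_smul_comm, ← pow_add]
  exact V.smul_mem _ (hK _ (by omega))

/-- If `a ^ N` is absorbed by `a * c`, then so is every power of `a` beyond `N`, any number of
times. -/
theorem pow_eq_pow_mul_mul_pow {A : Type*} [CommMonoid A] {a c : A} {N : ℕ}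
    (h : a ^ N = a ^ (N + 1) * c) {M : ℕ} (hM : N ≤ M) (k : ℕ) :
    a ^ M = a ^ M * (a * c) ^ k := by
  have h₁ : a ^ M = a ^ M * (a * c) := by
    obtain ⟨d, rfl⟩ := Nat.exists_eq_add_of_le hM
    calc a ^ (N + d) = a ^ (N + 1) * c * a ^ d := by rw [pow_add, ← h]
      _ = a ^ (N + d) * (a * c) := by
        rw [pow_succ, pow_add]
        ac_rfl
  induction k with
  | zero => simp
  | succ k ih => rw [pow_succ, ← mul_assoc, ← ih, ← h₁]

/-- A co-integral element of the radical of `V` has a power lying in the ideal generated by an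
idempotent of `V`. -/
theorem CoIntegral.exists_idempotent_mem {R A : Type*} [CommRing R] [CommRing A] [Algebra R A]
    {V : Submodule R A} {a : A} (hc : CoIntegral R a) (ha : a ∈ radSet (V : Set A)) :
    ∃ e ∈ V, e ^ 2 = e ∧ ∃ M : ℕ, a ^ M = a ^ M * e := by
  obtain ⟨N, p, hp⟩ := hc
  obtain ⟨K, hK⟩ := exists_pow_mul_aeval_mem_of_mem_radSet ha
  have h := pow_eq_pow_mul_mul_pow hp (le_max_left N K) (max N K)
  refine ⟨(a * Polynomial.aeval a p) ^ max N K, ?_, ?_, max N K, h⟩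
  · simpa [mul_pow] using hK _ (le_max_right N K) (p ^ max N K)
  · calc ((a * Polynomial.aeval a p) ^ max N K) ^ 2
        = a ^ max N K * (a * Polynomial.aeval a p) ^ max N K
            * Polynomial.aeval a p ^ max N K := by ring
      _ = (a * Polynomial.aeval a p) ^ max N K := by rw [← h, mul_pow]

/-- If `V` contains the principal ideals generated by the elements of `S`, it contains the ideal
generated by `S`. -/
theorem mem_of_mem_ideal_span {R A : Type*} [CommRing R] [CommRing A] [Algebra R A]
    {V : Submodule R A} {S : Set A} (hS : ∀ e ∈ S, ∀ x : A, x * e ∈ V) {y : A}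
    (hy : y ∈ Ideal.span S) : y ∈ V := by
  induction hy using Submodule.closure_induction with
  | zero => exact V.zero_mem
  | add _ _ _ _ hx hy => exact V.add_mem hx hy
  | smul_mem r x hx => exact hS x hx r

theorem mathieu_iff_idempotents {R A : Type*} [CommRing R] [CommRing A] [Algebra R A]
    (V : Submodule R A)
    (hG : ∀ a ∈ radSet (V : Set A),
      a ∈ Ideal.span {x : A | x ∈ radSet (V : Set A) ∧ CoIntegral R x}) :
    IsMathieu V ↔ ∀ e : A, e ∈ V → e ^ 2 = e → ∀ x : A, x * e ∈ V := by
  constructor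
  · intro hV e he hee x
    have hpow : ∀ m : ℕ, 1 ≤ m → e ^ m = e := fun m hm =>
      IsIdempotentElem.pow_eq (by rwa [IsIdempotentElem, ← sq]) (by omega)
    obtain ⟨N, hN⟩ := hV e x fun m hm => by rwa [hpow m hm]
    simpa only [hpow (N + 1) (by omega)] using hN (N + 1) (by omega)
  · intro hI a b ha
    let J : Ideal A := Ideal.span {e | e ∈ V ∧ e ^ 2 = e}
    have hle : Ideal.span {x : A | x ∈ radSet (V : Set A) ∧ CoIntegral R x} ≤ J.radical := by
      refine Ideal.span_le.2 fun x ⟨hx, hc⟩ => ?_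
      obtain ⟨e, he, hee, M, hM⟩ := hc.exists_idempotent_mem hx
      refine ⟨M, ?_⟩
      rw [hM]
      exact J.mul_mem_left _ (Ideal.subset_span ⟨he, hee⟩)
    obtain ⟨N, hN⟩ := hle (hG a ⟨1, ha⟩)
    exact ⟨N, fun m hm => mem_of_mem_ideal_span (fun e he => hI e he.1 he.2)
      (J.mul_mem_left b (J.pow_mem_of_pow_mem hN hm))⟩
end

section
/- Let R be a commutative ring, A a commutative unital R-algebra, and V an R-submodule of A such that every element of the radical r(V) lies in the ideal of A generated by the co-integral elements of r(V). If r(V) is an ideal of A, then r(V) is a radical ideal of A, i.e. whenever a^n ∈ r(V) for some n ≥ 1 we have a ∈ r(V). -/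
/-- If `x ^ N = x ^ (N + 1) * q` with `x ∈ I`, then `x` is nilpotent modulo an idempotent of `I`. -/
theorem exists_idempotent_isNilpotent_mul_one_sub {A : Type*} [CommRing A] {I : Ideal A}
    {x q : A} {N : ℕ} (hx : x ∈ I) (h : x ^ N = x ^ (N + 1) * q) :
    ∃ e ∈ I, IsIdempotentElem e ∧ IsNilpotent (x * (1 - e)) := by
  have absorb (j : ℕ) : x ^ N * (x * q) ^ j = x ^ N := by
    induction j with
    | zero => simp
    | succ j ih =>
      calc x ^ N * (x * q) ^ (j + 1) = x ^ N * (x * q) ^ j * (x * q) := by ring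
        _ = x ^ (N + 1) * q := by rw [ih]; ring
        _ = x ^ N := h.symm
  refine ⟨(x * q) ^ (N + 1), ?_, ?_, N + 1, ?_⟩
  · rw [pow_succ]
    exact I.mul_mem_left _ (I.mul_mem_right _ hx)
  · calc (x * q) ^ (N + 1) * (x * q) ^ (N + 1)
        = x ^ N * (x * q) ^ (N + 1) * q ^ N * (x * q) := by ring
      _ = (x * q) ^ (N + 1) := by rw [absorb]; ring
  · rw [mul_pow, pow_succ (1 - _), pow_succ x]
    linear_combination -x * (1 - (x * q) ^ (N + 1)) ^ N * absorb (N + 1)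

/-- The elements that are nilpotent modulo an idempotent of `I` are closed under ideal span. -/
theorem exists_idempotent_isNilpotent_of_mem_span {A : Type*} [CommRing A] {I : Ideal A}
    {s : Set A} (hs : ∀ x ∈ s, ∃ e ∈ I, IsIdempotentElem e ∧ IsNilpotent (x * (1 - e)))
    {y : A} (hy : y ∈ Ideal.span s) :
    ∃ e ∈ I, IsIdempotentElem e ∧ IsNilpotent (y * (1 - e)) := by
  induction hy using Submodule.span_induction with
  | mem x hx => exact hs x hx
  | zero => exact ⟨0, I.zero_mem, IsIdempotentElem.zero, by simp⟩
  | add y z _ _ hy hz =>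
    obtain ⟨e, heI, he, hye⟩ := hy
    obtain ⟨f, hfI, hf, hzf⟩ := hz
    refine ⟨e + f - e * f, I.sub_mem (I.add_mem heI hfI) (I.mul_mem_left _ hfI), ?_, ?_⟩
    · unfold IsIdempotentElem at *
      grind
    · have hsplit : (y + z) * (1 - (e + f - e * f)) =
          y * (1 - e) * (1 - f) + z * (1 - f) * (1 - e) := by ring
      rw [hsplit]
      exact (Commute.all _ _).isNilpotent_add ((Commute.all _ _).isNilpotent_mul_right hye)
        ((Commute.all _ _).isNilpotent_mul_right hzf)
  | smul c y _ hy =>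
    obtain ⟨e, heI, he, hye⟩ := hy
    refine ⟨e, heI, he, ?_⟩
    rw [smul_eq_mul, mul_assoc]
    exact (Commute.all _ _).isNilpotent_mul_left hye

theorem radical_is_radical_ideal {R A : Type*} [CommRing R] [CommRing A] [Algebra R A]
    (V : Submodule R A)
    (hG : ∀ a ∈ radSet (V : Set A),
      a ∈ Ideal.span {x : A | x ∈ radSet (V : Set A) ∧ CoIntegral R x})
    (hid : ∃ I : Ideal A, (I : Set A) = radSet (V : Set A)) :
    ∀ (a : A) (n : ℕ), 1 ≤ n → a ^ n ∈ radSet (V : Set A) → a ∈ radSet (V : Set A) := by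
  intro a n _ ha
  obtain ⟨I, hI⟩ := hid
  obtain ⟨e, heI, he, k, hk⟩ := exists_idempotent_isNilpotent_of_mem_span (I := I)
    (by
      rintro x ⟨hx, _, _, h⟩
      rw [← hI] at hx
      exact exists_idempotent_isNilpotent_mul_one_sub hx h) (hG _ ha)
  have hae : a * e ∈ radSet (V : Set A) := hI ▸ I.mul_mem_left a heI
  obtain ⟨M, hM⟩ := hae
  refine ⟨M + n * k + 1, fun m hm => ?_⟩
  have hkill : a ^ (n * k) * (1 - e) = 0 := by
    calc a ^ (n * k) * (1 - e) = a ^ (n * k) * (1 - e) ^ (k + 1) := by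
          rw [he.one_sub.pow_succ_eq]
      _ = (a ^ n * (1 - e)) ^ k * (1 - e) := by rw [mul_pow, pow_mul, pow_succ, mul_assoc]
      _ = 0 := by rw [hk, zero_mul]
  have hpow : a ^ m = (a * e) ^ m := by
    obtain ⟨d, rfl⟩ : ∃ d, m = n * k + d + 1 := ⟨m - n * k - 1, by omega⟩
    rw [mul_pow, he.pow_succ_eq]
    linear_combination a ^ (d + 1) * hkill
  rw [hpow]
  exact hM m (by omega)
end

section
/- Let R be a commutative ring, A a commutative unital R-algebra, and M an R-submodule of A. Let I_M denote the largest ideal of A contained in M (the sum of all ideals of A contained in M). Then M is a strong Mathieu subspace of A if and only if r(M) = r(I_M). Furthermore, if M is a strong Mathieu subspace of A, then every R-submodule V of A with I_M ⊆ V ⊆ M is a strong Mathieu subspace of A and satisfies r(V) = r(I_M). -/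
/-- `M` is a strong Mathieu subspace of the commutative `R`-algebra `A`. -/
def IsStrongMathieu {R A : Type*} [CommRing R] [CommRing A] [Algebra R A]
    (M : Submodule R A) : Prop :=
  ∀ a : A, (∀ m : ℕ, 1 ≤ m → a ^ m ∈ M) →
    ∃ N : ℕ, ((Ideal.span {a ^ N} : Ideal A) : Set A) ⊆ (M : Set A)

/-- The largest ideal of `A` contained in the `R`-submodule `M`:
the sum of all ideals of `A` contained in `M`. -/
def maxIdealIn {R A : Type*} [CommRing R] [CommRing A] [Algebra R A]
    (M : Submodule R A) : Ideal A :=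
  sSup {I : Ideal A | (I : Set A) ⊆ (M : Set A)}

section

variable {R A : Type*} [CommRing R] [CommRing A] [Algebra R A]

theorem radSet_mono {A : Type*} [Monoid A] {S T : Set A} (h : S ⊆ T) : radSet S ⊆ radSet T :=
  fun _ ⟨N, hN⟩ => ⟨N, fun m hm => h (hN m hm)⟩

theorem mem_radSet_ideal_of_pow_mem {I : Ideal A} {a : A} {n : ℕ} (h : a ^ n ∈ I) :
    a ∈ radSet (I : Set A) :=
  ⟨n, fun _ hm => I.mem_of_dvd (pow_dvd_pow a hm) h⟩

/-- The ideal of all `x` such that every multiple of `x` lies in `M`. -/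
def idealOfMulMem (M : Submodule R A) : Ideal A where
  carrier := {x | ∀ c : A, c * x ∈ M}
  zero_mem' c := by simp
  add_mem' hx hy c := by
    rw [mul_add]
    exact M.add_mem (hx c) (hy c)
  smul_mem' b x hx c := by
    rw [smul_eq_mul, ← mul_assoc]
    exact hx (c * b)

theorem maxIdealIn_subset (M : Submodule R A) : (maxIdealIn M : Set A) ⊆ M := by
  have h : maxIdealIn M ≤ idealOfMulMem M :=
    sSup_le fun I hI x hx c => hI (I.mul_mem_left c hx)
  intro x hx
  simpa using h hx 1

theorem le_maxIdealIn {M : Submodule R A} {I : Ideal A} (h : (I : Set A) ⊆ M) :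
    I ≤ maxIdealIn M :=
  le_sSup h

theorem IsStrongMathieu.radSet_subset {M : Submodule R A} (hM : IsStrongMathieu M) :
    radSet (M : Set A) ⊆ radSet (maxIdealIn M : Set A) := by
  rintro a ⟨N, hN⟩
  obtain ⟨K, hK⟩ := hM (a ^ (N + 1)) fun m hm => by
    rw [← pow_mul]
    exact hN _ (by nlinarith)
  rw [← pow_mul] at hK
  exact mem_radSet_ideal_of_pow_mem (le_maxIdealIn hK (Ideal.mem_span_singleton_self _))

theorem IsStrongMathieu.of_radSet_subset {V : Submodule R A} {I : Ideal A}
    (hI : (I : Set A) ⊆ V) (h : radSet (V : Set A) ⊆ radSet (I : Set A)) :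
    IsStrongMathieu V := by
  intro a ha
  obtain ⟨N, hN⟩ := h ⟨1, ha⟩
  exact ⟨N, fun x hx => hI ((Ideal.span_singleton_le_iff_mem I).2 (hN N le_rfl) hx)⟩

end

theorem strongMathieu_iff_radical_eq {R A : Type*} [CommRing R] [CommRing A] [Algebra R A]
    (M : Submodule R A) :
    (IsStrongMathieu M ↔ radSet (M : Set A) = radSet ((maxIdealIn M : Ideal A) : Set A)) ∧
      (IsStrongMathieu M → ∀ V : Submodule R A,
        ((maxIdealIn M : Ideal A) : Set A) ⊆ (V : Set A) → (V : Set A) ⊆ (M : Set A) →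
          IsStrongMathieu V ∧
            radSet (V : Set A) = radSet ((maxIdealIn M : Ideal A) : Set A)) := by
  refine ⟨⟨fun hM => hM.radSet_subset.antisymm (radSet_mono (maxIdealIn_subset M)),
    fun h => .of_radSet_subset (maxIdealIn_subset M) h.subset⟩, fun hM V hIV hVM => ?_⟩
  have h : radSet (V : Set A) ⊆ radSet (maxIdealIn M : Set A) :=
    (radSet_mono hVM).trans hM.radSet_subset
  exact ⟨.of_radSet_subset hIV h, h.antisymm (radSet_mono hIV)⟩
end

section
/- Let R be a commutative ring, A an associative unital R-algebra, and a ∈ A a nonzero element. If the R-submodule R * a is a two-sided Mathieu subspace of A and a is a quasi-idempotent of A (i.e. a = r * a² for some unit r of R), then R * a is a two-sided ideal of A. -/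
theorem eq_pow_smul_pow_succ {R A : Type*} [CommRing R] [Ring A] [Algebra R A] {a : A} {r : R}
    (h : a = r • a ^ 2) (n : ℕ) : a = r ^ n • a ^ (n + 1) := by
  induction n with
  | zero => simp
  | succ k ih =>
    calc a = r ^ k • (a ^ k * a) := by rw [← pow_succ]; exact ih
      _ = r ^ k • (a ^ k * (r • a ^ 2)) := by rw [← h]
      _ = r ^ (k + 1) • a ^ (k + 1 + 1) := by
        rw [mul_smul_comm, smul_smul, ← pow_succ, ← pow_add]

theorem pow_succ_mem_span_of_quasiIdempotent {R A : Type*} [CommRing R] [Ring A] [Algebra R A]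
    {a : A} {r : Rˣ} (h : a = (r : R) • a ^ 2) (n : ℕ) :
    a ^ (n + 1) ∈ Submodule.span R ({a} : Set A) := by
  have hn : a = (r ^ n) • a ^ (n + 1) := by
    simpa [Units.smul_def] using eq_pow_smul_pow_succ h n
  refine Submodule.mem_span_singleton.mpr ⟨((r ^ n)⁻¹ : Rˣ), ?_⟩
  exact (eq_inv_smul_iff.mpr hn.symm).symm

/-- If the span of a quasi-idempotent is a Mathieu subspace, it contains `b * a * c`. -/
theorem IsMathieuTS.mul_mul_mem_span_of_quasiIdempotent {R A : Type*} [CommRing R] [Ring A]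
    [Algebra R A] {a : A} (hM : IsMathieuTS (Submodule.span R ({a} : Set A)))
    {r : Rˣ} (h : a = (r : R) • a ^ 2) (b c : A) :
    b * a * c ∈ Submodule.span R ({a} : Set A) := by
  obtain ⟨N, hN⟩ := hM a b c fun m hm ↦ by
    obtain ⟨k, rfl⟩ := Nat.exists_eq_add_of_le' hm
    exact pow_succ_mem_span_of_quasiIdempotent h k
  have key := Submodule.smul_mem _ ((r : R) ^ N) (hN (N + 1) N.le_succ)
  rwa [← smul_mul_assoc, ← mul_smul_comm, ← eq_pow_smul_pow_succ h N] at key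

theorem span_singleton_ideal_of_quasiIdempotent {R A : Type*} [CommRing R] [Ring A]
    [Algebra R A] (a : A) (ha : a ≠ 0)
    (hM : IsMathieuTS (Submodule.span R ({a} : Set A)))
    (hqi : ∃ r : Rˣ, a = (r : R) • a ^ 2) :
    ∀ x ∈ Submodule.span R ({a} : Set A), ∀ b : A,
      b * x ∈ Submodule.span R ({a} : Set A) ∧ x * b ∈ Submodule.span R ({a} : Set A) := by
  obtain ⟨r, hr⟩ := hqi
  intro x hx b
  obtain ⟨s, rfl⟩ := Submodule.mem_span_singleton.mp hx
  rw [mul_smul_comm, smul_mul_assoc]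
  constructor
  · simpa using Submodule.smul_mem _ s (hM.mul_mul_mem_span_of_quasiIdempotent hr b 1)
  · simpa using Submodule.smul_mem _ s (hM.mul_mul_mem_span_of_quasiIdempotent hr 1 b)
end

section
/- Let D be a valuation ring (an integral domain in which for any two elements one divides the other) with field of fractions K. Let p be a prime ideal of D of height one. Then the D-submodule of K given by the image of p under the canonical map D → K is a Mathieu subspace of K over D. -/
/-- `M` is a Mathieu subspace of `K` over `D`. -/
def IsMathieuSub {D K : Type*} [CommRing D] [CommRing K] [Algebra D K]
    (M : Submodule D K) : Prop :=
  ∀ a b : K, (∀ m : ℕ, 1 ≤ m → a ^ m ∈ M) →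
    ∃ N : ℕ, ∀ m : ℕ, N ≤ m → b * a ^ m ∈ M

/-- `p` is a prime ideal of height one: it is a nonzero prime ideal and every
prime ideal strictly contained in it is zero. -/
def HeightOnePrime {D : Type*} [CommRing D] (p : Ideal D) : Prop :=
  p.IsPrime ∧ p ≠ ⊥ ∧ ∀ q : Ideal D, q.IsPrime → q < p → q = ⊥

/-- In a valuation ring, every nonzero element divides a power of each element of a height one
prime ideal. -/
theorem HeightOnePrime.exists_dvd_pow {D : Type*} [CommRing D] [IsDomain D] [ValuationRing D]
    {p : Ideal D} (hp : HeightOnePrime p) {x s : D} (hx : x ∈ p) (hs : s ≠ 0) :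
    ∃ n : ℕ, s ∣ x ^ n := by
  by_contra! h
  have hxr : x ∉ (Ideal.span {s}).radical := by
    rintro ⟨n, hn⟩
    exact h n (Ideal.mem_span_singleton.mp hn)
  simp only [Ideal.radical_eq_sInf, Submodule.mem_sInf, Set.mem_ofPred_eq, not_forall] at hxr
  obtain ⟨q, ⟨hsq, hq⟩, hxq⟩ := hxr
  have hle : q ≤ p := fun y hy =>
    (ValuationRing.dvd_total x y).elim (fun hxy => Ideal.mem_of_dvd p hxy hx)
      fun hyx => absurd (Ideal.mem_of_dvd q hyx hy) hxq
  have hbot := hp.2.2 q hq (lt_of_le_of_ne hle fun he => hxq (he ▸ hx))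
  have hsq' : s ∈ q := hsq (Ideal.mem_span_singleton_self s)
  rw [hbot] at hsq'
  exact hs (by simpa using hsq')

theorem heightOnePrime_is_mathieu {D : Type*} [CommRing D] [IsDomain D] [ValuationRing D]
    (p : Ideal D) (hp : HeightOnePrime p) :
    IsMathieuSub (Submodule.map (Algebra.linearMap D (FractionRing D)) p) := by
  intro a b ha
  obtain ⟨x, hx, hxa⟩ := by simpa using ha 1 le_rfl
  obtain ⟨r, s, hs, rfl⟩ := IsFractionRing.div_surjective (A := D) b
  have hs0 : s ≠ 0 := nonZeroDivisors.ne_zero hs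
  have hsK : algebraMap D (FractionRing D) s ≠ 0 := by simpa using hs0
  obtain ⟨n, c, hc⟩ := hp.exists_dvd_pow hx hs0
  refine ⟨n + 1, fun m hm => ?_⟩
  obtain ⟨k, rfl⟩ := Nat.exists_eq_add_of_le hm
  refine ⟨r * c * x ^ k * x, p.mul_mem_left _ hx, ?_⟩
  have hcK := congrArg (algebraMap D (FractionRing D)) hc
  simp only [map_pow, map_mul] at hcK
  subst hxa
  simp only [Algebra.linearMap_apply, map_mul, map_pow, pow_add, pow_one, hcK]
  field_simp
end
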